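/- Let a < b be real numbers and let f : ℝ → ℝ be twice differentiable on an open interval containing [a,b] with f'' Lebesgue integrable on [a,b]. Let q ≥ 1. If the function x ↦ |f''(x)|^q is convex on [a,b] and f'(a) = f'(b), then |(1/(b−a))·∫_a^b f(x) dx − (f(a)+f(b))/2| ≤ ((b−a)²/48) · ( ((|f''(a)|^q + 7·|f''(b)|^q)/8)^(1/q) + ((7·|f''(a)|^q + |f''(b)|^q)/8)^(1/q) ). -/

import Mathlib

lemma tangent_aux (p y y0 : ℝ) (hp0 : 0 ≤ p) (hp1 : p ≤ 1) (hy : 0 ≤ y) (hy0 : 0 < y0) :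
    y ^ p ≤ y0 ^ p + (y0 ^ p * p / y0) * (y - y0) := by
  have hs : -1 ≤ y / y0 - 1 := by
    have : 0 ≤ y / y0 := by positivity
    linarith
  have h := rpow_one_add_le_one_add_mul_self hs hp0 hp1
  have e : 1 + (y / y0 - 1) = y / y0 := by ring
  rw [e, Real.div_rpow hy hy0.le] at h
  have hpos : 0 < y0 ^ p := Real.rpow_pos_of_pos hy0 p
  rw [div_le_iff₀ hpos] at h
  refine h.trans (le_of_eq ?_)
  field_simp

lemma lin_bound (g : ℝ → ℝ) (a b q : ℝ) (hab : a < b) (hq : 1 ≤ q)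
    (hconv : ConvexOn ℝ (Set.Icc a b) (fun x => |g x| ^ q)) (t : ℝ) (ht0 : 0 < t) (ht1 : t < 1) :
    ∃ k : ℝ, ∀ x ∈ Set.Icc a b,
      |g x| ≤ ((1 - t) * |g a| ^ q + t * |g b| ^ q) ^ (1 / q) + k * (x - ((1 - t) * a + t * b)) := by
  have hq0 : 0 < q := by linarith
  have hA : 0 ≤ |g a| ^ q := by positivity
  have hB : 0 ≤ |g b| ^ q := by positivity
  have hba : 0 < b - a := by linarith
  have hG : ∀ x ∈ Set.Icc a b,
      |g x| ^ q ≤ (b - x) / (b - a) * |g a| ^ q + (x - a) / (b - a) * |g b| ^ q := by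
    intro x hx
    have n1 : 0 ≤ (b - x) / (b - a) := div_nonneg (by linarith [hx.2]) hba.le
    have n2 : 0 ≤ (x - a) / (b - a) := div_nonneg (by linarith [hx.1]) hba.le
    have n3 : (b - x) / (b - a) + (x - a) / (b - a) = 1 := by field_simp; ring
    have h := hconv.2 (Set.left_mem_Icc.2 hab.le) (Set.right_mem_Icc.2 hab.le) n1 n2 n3
    have e : (b - x) / (b - a) * a + (x - a) / (b - a) * b = x := by
      field_simp; ring
    simpa only [smul_eq_mul, e] using h
  have hr : ∀ x, (|g x| ^ q) ^ (1 / q) = |g x| := by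
    intro x
    rw [← Real.rpow_mul (abs_nonneg _), mul_one_div_cancel hq0.ne', Real.rpow_one]
  generalize |g a| ^ q = A at *
  generalize |g b| ^ q = B at *
  have hp1 : 1 / q ≤ 1 := by rw [div_le_one hq0]; exact hq
  have hp0 : 0 ≤ 1 / q := by positivity
  have hy00 : 0 ≤ (1 - t) * A + t * B := by
    have : 0 ≤ 1 - t := by linarith
    positivity
  rcases hy00.eq_or_lt with h0 | hpos
  · have hA0 : A = 0 := by nlinarith [mul_nonneg (sub_pos.2 ht1).le hA, mul_nonneg ht0.le hB]
    have hB0 : B = 0 := by nlinarith [mul_nonneg (sub_pos.2 ht1).le hA, mul_nonneg ht0.le hB]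
    refine ⟨0, fun x hx => ?_⟩
    have h := hG x hx
    rw [hA0, hB0] at h
    have h2 : |g x| ^ q = 0 := le_antisymm (by simpa using h) (by positivity)
    have h3 := hr x
    rw [h2] at h3
    rw [hA0, hB0, ← h3]
    simp
  · set y0 := (1 - t) * A + t * B with hy0
    refine ⟨(y0 ^ (1 / q) * (1 / q) / y0) * ((B - A) / (b - a)), fun x hx => ?_⟩
    have h := hG x hx
    have h1 := Real.rpow_le_rpow (by positivity) h hp0
    rw [hr] at h1
    have h2 := tangent_aux (1 / q) _ y0 hp0 hp1 (le_trans (by positivity) h) hpos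
    refine h1.trans (h2.trans (le_of_eq ?_))
    rw [mul_assoc]
    congr 2
    rw [hy0]
    field_simp
    ring

lemma int_aux (m c k x0 s t : ℝ) :
    ∫ x in s..t, (x - m) ^ 2 * (c + k * (x - x0)) =
      ((c - k * x0 + k * m) * (t - m) ^ 3 / 3 + k * (t - m) ^ 4 / 4)
      - ((c - k * x0 + k * m) * (s - m) ^ 3 / 3 + k * (s - m) ^ 4 / 4) := by
  rw [intervalIntegral.integral_eq_sub_of_hasDerivAt
    (f := fun x => (c - k * x0 + k * m) * (x - m) ^ 3 / 3 + k * (x - m) ^ 4 / 4)]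
  · intro x _
    have h0 : HasDerivAt (fun x : ℝ => x - m) 1 x := (hasDerivAt_id x).sub_const m
    have h := (((h0.pow 3).const_mul (c - k * x0 + k * m)).div_const 3).add
      (((h0.pow 4).const_mul k).div_const 4)
    refine HasDerivAt.congr_deriv h ?_
    norm_num
    ring
  · apply Continuous.intervalIntegrable
    fun_prop

lemma half_aux (g : ℝ → ℝ) (m c k x0 s t : ℝ) (hst : s ≤ t)
    (hi : IntervalIntegrable g MeasureTheory.volume s t)
    (hb : ∀ x ∈ Set.Icc s t, |g x| ≤ c + k * (x - x0)) :
    |∫ x in s..t, (x - m) ^ 2 * g x| ≤ 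
      ((c - k * x0 + k * m) * (t - m) ^ 3 / 3 + k * (t - m) ^ 4 / 4)
      - ((c - k * x0 + k * m) * (s - m) ^ 3 / 3 + k * (s - m) ^ 4 / 4) := by
  rw [← int_aux, ← Real.norm_eq_abs]
  apply intervalIntegral.norm_integral_le_of_norm_le hst
  · refine Filter.Eventually.of_forall fun x hx => ?_
    rw [Real.norm_eq_abs, abs_mul, abs_of_nonneg (sq_nonneg _)]
    exact mul_le_mul_of_nonneg_left (hb x ⟨hx.1.le, hx.2⟩) (sq_nonneg _)
  · apply Continuous.intervalIntegrable
    fun_prop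

/-- Corollary: trapezoid power-mean-type inequality for |f''|^q convex, q ≥ 1,
assuming f'(a) = f'(b). -/
theorem stmt_9 (f f' f'' : ℝ → ℝ) (a b u v q : ℝ) (hab : a < b)
(hua : u < a) (hbv : b < v)
    (hf' : ∀ x ∈ Set.Ioo u v, HasDerivAt f (f' x) x)
    (hf'' : ∀ x ∈ Set.Ioo u v, HasDerivAt f' (f'' x) x)
    (hint : IntervalIntegrable f'' MeasureTheory.volume a b)
    (hq : 1 ≤ q)
    (hconv : ConvexOn ℝ (Set.Icc a b) (fun x => |f'' x| ^ q))
    (hder : f' a = f' b) :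
    |(1 / (b - a)) * (∫ x in a..b, f x) - (f a + f b) / 2|
      ≤ ((b - a) ^ 2 / 48) *
          (((|f'' a| ^ q + 7 * |f'' b| ^ q) / 8) ^ (1 / q)
            + ((7 * |f'' a| ^ q + |f'' b| ^ q) / 8) ^ (1 / q)) := by
  have hsub : ∀ x ∈ Set.uIcc a b, x ∈ Set.Ioo u v := by
    intro x hx
    rw [Set.uIcc_of_le hab.le] at hx
    exact ⟨by linarith [hx.1], by linarith [hx.2]⟩
  obtain ⟨m, hm⟩ : ∃ m, m = (a + b) / 2 := ⟨_, rfl⟩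
  have hfc : ContinuousOn f (Set.uIcc a b) :=
    fun x hx => (hf' x (hsub x hx)).continuousAt.continuousWithinAt
  have hfi : IntervalIntegrable f MeasureTheory.volume a b := hfc.intervalIntegrable
  have hwi : IntervalIntegrable (fun x => (x - m) ^ 2 * f'' x) MeasureTheory.volume a b :=
    hint.continuousOn_mul (by fun_prop)
  have hkey : (∫ x in a..b, (x - m) ^ 2 * f'' x) = 2 * (∫ x in a..b, f x) - (b - a) * (f a + f b) := by
    have h := intervalIntegral.integral_eq_sub_of_hasDerivAt
      (f := fun x => (x - m) ^ 2 * f' x - 2 * (x - m) * f x)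
      (f' := fun x => (x - m) ^ 2 * f'' x - 2 * f x) (a := a) (b := b) ?_
      (hwi.sub (hfi.const_mul 2))
    · rw [intervalIntegral.integral_sub hwi (hfi.const_mul 2),
        intervalIntegral.integral_const_mul] at h
      simp only [hder] at h
      rw [eq_sub_iff_add_eq, ← sub_eq_zero]
      rw [← sub_eq_zero] at h
      rw [← h, hm]
      ring
    · intro x hx
      have h0 : HasDerivAt (fun x : ℝ => x - m) 1 x := (hasDerivAt_id x).sub_const m
      have h := ((h0.pow 2).mul (hf'' x (hsub x hx))).sub
        ((h0.const_mul 2).mul (hf' x (hsub x hx)))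
      refine HasDerivAt.congr_deriv h ?_
      norm_num
      ring
  have ham : a ≤ m := by linarith
  have hmb : m ≤ b := by linarith
  have hmm : m ∈ Set.uIcc a b := by rw [Set.uIcc_of_le hab.le]; exact ⟨ham, hmb⟩
  have s1 : Set.uIcc a m ⊆ Set.uIcc a b := Set.uIcc_subset_uIcc Set.left_mem_uIcc hmm
  have s2 : Set.uIcc m b ⊆ Set.uIcc a b := Set.uIcc_subset_uIcc hmm Set.right_mem_uIcc
  have hsplit := intervalIntegral.integral_add_adjacent_intervals
    (hwi.mono_set s1) (hwi.mono_set s2)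
  obtain ⟨k1, hk1⟩ := lin_bound f'' a b q hab hq hconv (1 / 8) (by norm_num) (by norm_num)
  obtain ⟨k2, hk2⟩ := lin_bound f'' a b q hab hq hconv (7 / 8) (by norm_num) (by norm_num)
  have b1 := half_aux f'' m _ k1 _ a m ham (hint.mono_set s1)
    (fun x hx => hk1 x ⟨hx.1, hx.2.trans hmb⟩)
  have b2 := half_aux f'' m _ k2 _ m b hmb (hint.mono_set s2)
    (fun x hx => hk2 x ⟨ham.trans hx.1, hx.2⟩)
  have e1 : (1 - 1 / 8) * |f'' a| ^ q + 1 / 8 * |f'' b| ^ q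
      = (7 * |f'' a| ^ q + |f'' b| ^ q) / 8 := by ring
  have e2 : (1 - 7 / 8) * |f'' a| ^ q + 7 / 8 * |f'' b| ^ q
      = (|f'' a| ^ q + 7 * |f'' b| ^ q) / 8 := by ring
  rw [e1] at b1
  rw [e2] at b2
  generalize ((7 * |f'' a| ^ q + |f'' b| ^ q) / 8) ^ (1 / q) = c1 at *
  generalize ((|f'' a| ^ q + 7 * |f'' b| ^ q) / 8) ^ (1 / q) = c2 at *
  have hba : 0 < b - a := by linarith
  have e : (1 / (b - a)) * (∫ x in a..b, f x) - (f a + f b) / 2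
      = (1 / (2 * (b - a))) * ∫ x in a..b, (x - m) ^ 2 * f'' x := by
    rw [hkey]
    field_simp
  rw [e, abs_mul, abs_of_pos (by positivity), ← hsplit]
  have b3 := (abs_add_le (∫ x in a..m, (x - m) ^ 2 * f'' x)
    (∫ x in m..b, (x - m) ^ 2 * f'' x)).trans (add_le_add b1 b2)
  refine (mul_le_mul_of_nonneg_left b3 (by positivity)).trans (le_of_eq ?_)
  rw [hm]
  field_simp
  ring
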